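/- Suppose h belongs to ℛ (i.e. Case 1 or Case 2 holds). Then K(x̂,t) = tψ(t) − g(ψ(t)) satisfies K(x̂,t) = ∫₁^t ψ(u) du + ψ(1) − g(ψ(1)), hence K(x̂,t) ~ ∫₁^t ψ(u) du as t → ∞; moreover K(x̂,t) ~ (β/(β+1)) · t ψ(t) in Case 1 and K(x̂,t) ~ t ψ(t) in Case 2. -/

import Mathlib

open Real Filter MeasureTheory Set ProbabilityTheory Asymptotics

noncomputable section

/-- `f` is regularly varying at infinity with index `α`: `f` is eventually positive and
`f (λ t) / f t → λ ^ α` as `t → ∞` for every `λ > 0`. -/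
def RegVary (α : ℝ) (f : ℝ → ℝ) : Prop :=
  (∀ᶠ x in atTop, 0 < f x) ∧
  ∀ lam : ℝ, 0 < lam →
    Tendsto (fun t => f (lam * t) / f t) atTop (nhds (lam ^ α))

/-- Case 1 (the regularly varying case) for the function `h = g'`:
`h x = c x^β exp (∫₁^x ε(u)/u du)` with `β > 0`, `c > 0`, `ε` twice differentiable with
`ε(x) → 0`, `x ε'(x) = O(1)`, `x² ε''(x) = O(1)`, and `|h''| ∈ RV(θ)` for some `θ ≤ β - 2`. -/
structure Case1 (h : ℝ → ℝ) (β c θ : ℝ) (ε : ℝ → ℝ) : Prop where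
  beta_pos : 0 < β
  c_pos : 0 < c
  h_eq : ∀ x ≥ (1:ℝ), h x = c * x ^ β * Real.exp (∫ u in (1:ℝ)..x, ε u / u)
  eps_diff : ∀ x ≥ (1:ℝ), DifferentiableAt ℝ ε x
  eps_diff2 : ∀ x ≥ (1:ℝ), DifferentiableAt ℝ (deriv ε) x
  eps_to_zero : Tendsto ε atTop (nhds 0)
  eps_deriv_bigO : (fun x => x * deriv ε x) =O[atTop] (fun _ => (1:ℝ))
  eps_deriv2_bigO : (fun x => x ^ 2 * deriv (deriv ε) x) =O[atTop] (fun _ => (1:ℝ))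
  h2_RV : RegVary θ (fun x => |deriv (deriv h) x|)
  theta_le : θ ≤ β - 2

/-- Case 2 (the rapidly varying case), stated through `ψ = h⁻¹`:
`ψ t = c exp (∫₁^t ε(u)/u du)` with `c > 0`, `ε` twice differentiable with `ε(t) → 0`,
`t ε'(t)/ε(t) → 0` and `t² ε''(t)/ε(t) → 0`. -/
structure Case2 (ψ : ℝ → ℝ) (c : ℝ) (ε : ℝ → ℝ) : Prop where
  c_pos : 0 < c
  psi_eq : ∀ t ≥ (1:ℝ), ψ t = c * Real.exp (∫ u in (1:ℝ)..t, ε u / u)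
  eps_diff : ∀ t ≥ (1:ℝ), DifferentiableAt ℝ ε t
  eps_diff2 : ∀ t ≥ (1:ℝ), DifferentiableAt ℝ (deriv ε) t
  eps_to_zero : Tendsto ε atTop (nhds 0)
  eps_ratio1 : Tendsto (fun t => t * deriv ε t / ε t) atTop (nhds 0)
  eps_ratio2 : Tendsto (fun t => t ^ 2 * deriv (deriv ε) t / ε t) atTop (nhds 0)

/-- A form of L'Hôpital's rule at infinity: if `f' = o(G')`, `G' ≥ 0` and `G → ∞`,
then `f = o(G)`. -/
theorem isLittleO_atTop_of_hasDerivAt {f f' G G' : ℝ → ℝ}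
    (hf : ∀ᶠ x in atTop, HasDerivAt f (f' x) x) (hG : ∀ᶠ x in atTop, HasDerivAt G (G' x) x)
    (hG' : ∀ᶠ x in atTop, 0 ≤ G' x) (hGtop : Tendsto G atTop atTop)
    (ho : f' =o[atTop] G') : f =o[atTop] G := by
  rw [isLittleO_iff]
  intro c hc
  obtain ⟨X, hX⟩ := eventually_atTop.1
    (hf.and (hG.and (hG'.and (ho.bound (half_pos hc)))))
  have hbound : ∀ x ≥ X, ‖f x‖ ≤ ‖f X‖ + c / 2 * (G x - G X) := by
    intro x hx
    refine image_norm_le_of_norm_deriv_right_le_deriv_boundary' (a := X) (b := x)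
      (B := fun y => ‖f X‖ + c / 2 * (G y - G X)) (B' := fun y => c / 2 * G' y) (f' := f')
      (fun y hy => (hX y hy.1).1.continuousAt.continuousWithinAt)
      (fun y hy => (hX y hy.1).1.hasDerivWithinAt) (by simp)
      (fun y hy => ?_) (fun y hy => ?_) (fun y hy => ?_) ⟨hx, le_rfl⟩
    · exact ((((hX y hy.1).2.1.sub_const _).const_mul _).const_add _).continuousAt.continuousWithinAt
    · exact ((((hX y hy.1).2.1.sub_const _).const_mul _).const_add _).hasDerivWithinAt
    · simpa [abs_of_nonneg (hX y hy.1).2.2.1] using (hX y hy.1).2.2.2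
  have hlarge := (hGtop.const_mul_atTop (half_pos hc)).eventually_ge_atTop
    (‖f X‖ - c / 2 * G X)
  filter_upwards [eventually_ge_atTop X, hlarge, hGtop.eventually_ge_atTop 0] with x hx hl h0
  rw [Real.norm_of_nonneg h0]
  linarith [hbound x hx]

/-- If `ψ` is a selection of subgradients of `K` on `[a, ∞)`, then `K` is a primitive of `ψ`. -/
theorem integral_eq_sub_of_subgradient {K ψ : ℝ → ℝ} {a : ℝ}
    (H : ∀ s ≥ a, ∀ t ≥ a, (s - t) * ψ t ≤ K s - K t) {t : ℝ} (ht : a ≤ t) :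
    IntervalIntegrable ψ volume a t ∧ ∫ u in a..t, ψ u = K t - K a := by
  have hmono : MonotoneOn ψ (Ici a) := by
    intro x hx y hy hxy
    rcases hxy.eq_or_lt with rfl | hlt
    · exact le_rfl
    · have h1 := H x hx y hy
      have h2 := H y hy x hx
      by_contra! hcon
      nlinarith [mul_pos (sub_pos.2 hlt) (sub_pos.2 hcon)]
  have habs : ∀ x ≥ a, ∀ y ≥ a, |K y - K x - (y - x) * ψ x| ≤ |ψ y - ψ x| * |y - x| := by
    intro x hx y hy
    have h1 := H x hx y hy
    have h2 := H y hy x hx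
    rw [abs_of_nonneg (by linarith), ← abs_mul]
    exact le_trans (by linarith) (le_abs_self _)
  have hInt : IntervalIntegrable ψ volume a t :=
    (hmono.mono (by rw [uIcc_of_le ht]; exact Icc_subset_Ici_self)).intervalIntegrable
  refine ⟨hInt, integral_eq_of_hasDerivAt_off_countable_of_le K ψ ht
    hmono.countable_not_continuousWithinAt ?_ ?_ hInt⟩
  · have hle : ∀ x ∈ Icc a t, ∀ y ∈ Icc a t, dist (K x) (K y) ≤ (|ψ a| + |ψ t|) * dist x y := by
      intro x hx y hy
      have h1 := H x hx.1 y hy.1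
      have h2 := H y hy.1 x hx.1
      have hb : ∀ z ∈ Icc a t, |ψ z| ≤ |ψ a| + |ψ t| := fun z hz => by
        have h3 := hmono self_mem_Ici hz.1 hz.1
        have h4 := hmono hz.1 ht hz.2
        rw [abs_le]
        constructor <;> linarith [neg_abs_le (ψ a), le_abs_self (ψ t), abs_nonneg (ψ a),
          abs_nonneg (ψ t)]
      have hx' := mul_le_mul_of_nonneg_left (hb x hx) (abs_nonneg (x - y))
      have hy' := mul_le_mul_of_nonneg_left (hb y hy) (abs_nonneg (x - y))
      rw [← abs_mul] at hx' hy'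
      rw [Real.dist_eq, Real.dist_eq, abs_le]
      constructor <;> linarith [neg_abs_le ((x - y) * ψ y), le_abs_self ((x - y) * ψ x)]
    exact (LipschitzOnWith.of_dist_le_mul (K := ⟨|ψ a| + |ψ t|, by positivity⟩) hle).continuousOn
  · rintro x ⟨hx, hxs⟩
    have hnhds : Ici a ∈ nhds x := Ici_mem_nhds hx.1
    have hc : ContinuousAt ψ x := by
      by_contra hcon
      exact hxs ⟨hx.1.le, fun h => hcon (h.continuousAt hnhds)⟩
    rw [hasDerivAt_iff_isLittleO, isLittleO_iff]
    intro c hc0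
    have hlim : Tendsto (fun y => |ψ y - ψ x|) (nhds x) (nhds 0) := by
      have := (hc.tendsto.sub_const (ψ x)).abs
      simpa using this
    filter_upwards [hnhds, hlim.eventually (gt_mem_nhds hc0)] with y hy hyc
    exact (habs x hx.1.le y hy).trans (mul_le_mul_of_nonneg_right hyc.le (abs_nonneg _))

/-- The exponential of `∫₁ ε(u)/u du` has logarithmic derivative `ε(x)/x`. -/
theorem hasDerivAt_exp_integral_div {ε : ℝ → ℝ} (hε : ∀ x ≥ (1 : ℝ), DifferentiableAt ℝ ε x)
    {x : ℝ} (hx : 1 < x) :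
    HasDerivAt (fun y => Real.exp (∫ u in (1 : ℝ)..y, ε u / u))
      (Real.exp (∫ u in (1 : ℝ)..x, ε u / u) * (ε x / x)) x := by
  have hcont : ∀ u ≥ (1 : ℝ), ContinuousAt (fun u => ε u / u) u := fun u hu =>
    (hε u hu).continuousAt.div continuousAt_id (by simp; linarith)
  have hcontOn : ContinuousOn (fun u => ε u / u) (Ioi 1) := fun u hu =>
    (hcont u (le_of_lt hu)).continuousWithinAt
  have hInt : IntervalIntegrable (fun u => ε u / u) volume 1 x := by
    refine ContinuousOn.intervalIntegrable fun u hu => ?_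
    rw [uIcc_of_le hx.le] at hu
    exact (hcont u hu.1).continuousWithinAt
  exact (intervalIntegral.integral_hasDerivAt_right hInt
    (hcontOn.stronglyMeasurableAtFilter isOpen_Ioi x hx) (hcont x hx.le)).exp

/-- Karamata's theorem in Case 1: `g(x) / (x g'(x)) → 1 / (β + 1)`. -/
theorem Case1.tendsto_div {g : ℝ → ℝ} {β c θ : ℝ} {ε : ℝ → ℝ} (h1 : Case1 (deriv g) β c θ ε)
    (hg : ∀ᶠ x in atTop, DifferentiableAt ℝ g x) (hgtop : Tendsto g atTop atTop)
    (hh : ∀ᶠ x in atTop, 0 < deriv g x) :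
    Tendsto (fun x => g x / (x * deriv g x)) atTop (nhds (1 / (β + 1))) := by
  have hβ := h1.beta_pos
  have hderiv : ∀ x > (1 : ℝ),
      HasDerivAt (fun y => y * deriv g y) ((1 + β + ε x) * deriv g x) x := by
    intro x hx
    have hx0 : x ≠ 0 := by linarith
    have hd := ((Real.hasDerivAt_rpow_const (p := β) (Or.inl hx0)).const_mul c).mul
      (hasDerivAt_exp_integral_div h1.eps_diff hx)
    have hd' := (hasDerivAt_id x).mul (hd.congr_of_eventuallyEq
      (f₁ := deriv g) (mem_of_superset (Ioi_mem_nhds hx) fun y hy => h1.h_eq y (le_of_lt hy)))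
    refine hd'.congr_deriv ?_
    rw [h1.h_eq x hx.le, Real.rpow_sub_one hx0]
    simp only [id]
    field_simp
    ring
  have ho : (fun x => x * deriv g x - (β + 1) * g x) =o[atTop] g := by
    refine isLittleO_atTop_of_hasDerivAt (f' := fun x => ε x * deriv g x) (G' := deriv g)
      ?_ (hg.mono fun x hx => hx.hasDerivAt) (hh.mono fun x hx => hx.le) hgtop ?_
    · filter_upwards [hg, eventually_gt_atTop 1] with x hx hx1
      exact ((hderiv x hx1).sub (hx.hasDerivAt.const_mul (β + 1))).congr_deriv (by ring)
    · simpa using ((isLittleO_one_iff ℝ).2 h1.eps_to_zero).mul_isBigO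
        (isBigO_refl (deriv g) atTop)
  have hlim := (ho.tendsto_div_nhds_zero.add_const (β + 1)).inv₀ (by positivity)
  rw [zero_add, ← one_div] at hlim
  refine hlim.congr' ?_
  filter_upwards [hgtop.eventually_gt_atTop 0] with x hx
  rw [← inv_div]
  field_simp
  ring

/-- Karamata's theorem in Case 2: `∫₁ᵗ ψ ~ t ψ(t)`. -/
theorem Case2.tendsto_div {ψ : ℝ → ℝ} {c : ℝ} {ε : ℝ → ℝ} (h2 : Case2 ψ c ε) {I : ℝ → ℝ}
    (hI : ∀ t > (1 : ℝ), ContinuousAt ψ t → HasDerivAt I (ψ t) t)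
    (hItop : Tendsto I atTop atTop) :
    Tendsto (fun t => I t / (t * ψ t)) atTop (nhds 1) := by
  have hψ : ∀ t > (1 : ℝ), HasDerivAt ψ (ε t / t * ψ t) t := by
    intro t ht
    have hd := (hasDerivAt_exp_integral_div h2.eps_diff ht).const_mul c
    refine (hd.congr_of_eventuallyEq (f₁ := ψ)
      (mem_of_superset (Ioi_mem_nhds ht) fun y hy => h2.psi_eq y (le_of_lt hy))).congr_deriv ?_
    rw [h2.psi_eq t ht.le]
    ring
  have hpos : ∀ t > (1 : ℝ), 0 < ψ t := fun t ht => by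
    rw [h2.psi_eq t (le_of_lt ht)]
    exact mul_pos h2.c_pos (Real.exp_pos _)
  have hI' : ∀ t > (1 : ℝ), HasDerivAt I (ψ t) t := fun t ht => hI t ht (hψ t ht).continuousAt
  have ho : (fun t => t * ψ t - I t) =o[atTop] I := by
    refine isLittleO_atTop_of_hasDerivAt (f' := fun t => ε t * ψ t) (G' := ψ)
      ((eventually_gt_atTop 1).mono fun t ht => ?_) ((eventually_gt_atTop 1).mono hI')
      ((eventually_gt_atTop 1).mono fun t ht => (hpos t ht).le) hItop ?_
    · refine (((hasDerivAt_id t).mul (hψ t ht)).sub (hI' t ht)).congr_deriv ?_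
      have ht0 : t ≠ 0 := by linarith
      simp only [id]
      field_simp
      ring
    · simpa using ((isLittleO_one_iff ℝ).2 h2.eps_to_zero).mul_isBigO (isBigO_refl ψ atTop)
  have hlim := (ho.tendsto_div_nhds_zero.add_const 1).inv₀ (by norm_num)
  rw [zero_add, inv_one] at hlim
  refine hlim.congr' ?_
  filter_upwards [hItop.eventually_gt_atTop 0] with t ht
  rw [← inv_div]
  field_simp
  ring

/-- The tangent line inequality for a differentiable convex function. -/
theorem ConvexOn.sub_le_deriv_mul {S : Set ℝ} {g : ℝ → ℝ} (hg : ConvexOn ℝ S g) {x y : ℝ}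
    (hx : x ∈ S) (hy : y ∈ S) (hd : DifferentiableAt ℝ g x) :
    g x - g y ≤ deriv g x * (x - y) := by
  rcases lt_trichotomy x y with h | rfl | h
  · have := hg.deriv_le_slope hx hy h hd
    rw [slope_def_field, le_div_iff₀ (sub_pos.2 h)] at this
    linarith
  · simp
  · have := hg.slope_le_deriv hy hx h hd
    rwa [slope_def_field, div_le_iff₀ (sub_pos.2 h)] at this

/-- `K(x̂,t) = tψ(t) − g(ψ(t)) = ∫₁^t ψ(u) du + ψ(1) − g(ψ(1))`, hence
`K(x̂,t) ~ ∫₁^t ψ(u) du` as `t → ∞`; moreover `K(x̂,t) ~ (β/(β+1)) t ψ(t)` in Case 1 and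
`K(x̂,t) ~ t ψ(t)` in Case 2. -/
theorem K_hat_asymptotic
    (g ψ : ℝ → ℝ)
    (hg_pos : ∀ x > (0:ℝ), 0 < g x)
    (hg_conv : ConvexOn ℝ (Set.Ioi 0) g)
    (hg_smooth : ContDiffOn ℝ 4 g (Set.Ioi 0))
    (hg_super : Tendsto (fun x => g x / x) atTop atTop)
    (hh_mono : ∃ x₀ : ℝ, StrictMonoOn (deriv g) (Set.Ioi x₀))
    (hh_top : Tendsto (deriv g) atTop atTop)
    (hψ_inv : ∀ᶠ t in atTop, deriv g (ψ t) = t)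
    (hψ_inv' : ∀ᶠ x in atTop, ψ (deriv g x) = x)
    (hψ_top : Tendsto ψ atTop atTop)
    (hψ_inv_ge : ∀ t ≥ (1:ℝ), deriv g (ψ t) = t ∧ 1 ≤ ψ t)
    (hcase :
      (∃ β c θ ε, Case1 (deriv g) β c θ ε) ∨ (∃ c ε, Case2 ψ c ε))
    : (∀ t ≥ (1:ℝ),
        t * ψ t - g (ψ t) = (∫ u in (1:ℝ)..t, ψ u) + ψ 1 - g (ψ 1)) ∧
    Tendsto (fun t => (t * ψ t - g (ψ t)) / ∫ u in (1:ℝ)..t, ψ u) atTop (nhds 1) ∧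
    (∀ β c θ ε, Case1 (deriv g) β c θ ε →
      Tendsto (fun t => (t * ψ t - g (ψ t)) / (β / (β + 1) * (t * ψ t)))
        atTop (nhds 1)) ∧
    (∀ c ε, Case2 ψ c ε →
      Tendsto (fun t => (t * ψ t - g (ψ t)) / (t * ψ t)) atTop (nhds 1)) := by
  have hdiff : ∀ x > (0 : ℝ), DifferentiableAt ℝ g x := fun x hx =>
    (hg_smooth.contDiffAt (Ioi_mem_nhds hx)).differentiableAt (by norm_num)
  have hψ1 : ∀ t ≥ (1 : ℝ), 1 ≤ ψ t := fun t ht => (hψ_inv_ge t ht).2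
  have hψ0 : ∀ t ≥ (1 : ℝ), 0 < ψ t := fun t ht => one_pos.trans_le (hψ1 t ht)
  have hsub : ∀ s ≥ (1 : ℝ), ∀ t ≥ (1 : ℝ),
      (s - t) * ψ t ≤ (s * ψ s - g (ψ s)) - (t * ψ t - g (ψ t)) := by
    intro s hs t ht
    have := hg_conv.sub_le_deriv_mul (hψ0 s hs) (hψ0 t ht) (hdiff _ (hψ0 s hs))
    rw [(hψ_inv_ge s hs).1] at this
    linarith
  have hprim := fun t (ht : (1 : ℝ) ≤ t) =>
    integral_eq_sub_of_subgradient (K := fun t => t * ψ t - g (ψ t)) hsub ht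
  have hK : ∀ t ≥ (1 : ℝ),
      t * ψ t - g (ψ t) = (∫ u in (1 : ℝ)..t, ψ u) + ψ 1 - g (ψ 1) := fun t ht => by
    linarith [(hprim t ht).2]
  have hItop : Tendsto (fun t => ∫ u in (1 : ℝ)..t, ψ u) atTop atTop := by
    refine tendsto_atTop_mono' atTop ?_ (tendsto_atTop_add_const_right atTop (-1) tendsto_id)
    filter_upwards [eventually_ge_atTop 1] with t ht
    have := intervalIntegral.integral_mono_on ht intervalIntegrable_const (hprim t ht).1
      (fun u hu => hψ1 u hu.1)
    simpa [sub_eq_add_neg] using this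
  have hKI : Tendsto (fun t => (t * ψ t - g (ψ t)) / ∫ u in (1 : ℝ)..t, ψ u) atTop (nhds 1) := by
    have hlim := ((tendsto_const_nhds (x := ψ 1 - g (ψ 1))).div_atTop hItop).const_add 1
    rw [add_zero] at hlim
    refine hlim.congr' ?_
    filter_upwards [eventually_ge_atTop 1, hItop.eventually_gt_atTop 0] with t ht hI
    rw [hK t ht]
    field_simp
    ring
  refine ⟨hK, hKI, fun β c θ ε h1 => ?_, fun c ε h2 => ?_⟩
  · have hβ := h1.beta_pos
    have hgtop : Tendsto g atTop atTop := by
      refine tendsto_atTop_mono' atTop ?_ (hg_super.atTop_mul_atTop₀ tendsto_id)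
      filter_upwards [eventually_gt_atTop 0] with x hx
      simp [hx.ne']
    have hlim := (h1.tendsto_div ((eventually_gt_atTop 0).mono hdiff) hgtop
      (hh_top.eventually_gt_atTop 0)).comp hψ_top
    have hlim' := (hlim.const_sub 1).div_const (β / (β + 1))
    have hone : (1 - 1 / (β + 1)) / (β / (β + 1)) = 1 := by
      field_simp
      ring
    rw [hone] at hlim'
    refine hlim'.congr' ?_
    filter_upwards [eventually_ge_atTop 1] with t ht
    have ht0 : t ≠ 0 := by linarith
    have hp := (hψ0 t ht).ne'
    simp only [Function.comp_apply, (hψ_inv_ge t ht).1]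
    field_simp
  · have hlim := hKI.mul (h2.tendsto_div (I := fun t => ∫ u in (1 : ℝ)..t, ψ u) ?_ hItop)
    · rw [mul_one] at hlim
      refine hlim.congr' ?_
      filter_upwards [hItop.eventually_gt_atTop 0] with t hI
      exact div_mul_div_cancel₀ hI.ne'
    · intro t ht hc
      refine intervalIntegral.integral_hasDerivAt_right (hprim t ht.le).1 ?_ hc
      refine ⟨Ioc 1 (t + 1), Ioc_mem_nhds ht (by linarith), ?_⟩
      exact (hprim (t + 1) (by linarith)).1.1.aestronglyMeasurable
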